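/- (Product estimate for the Besov-type Littlewood–Paley seminorm) Provided δ₁ ∈ (0, 1/100] is sufficiently small (an absolute smallness condition), there is a constant C, depending only on δ₁ and the bump function ϕ, such that for all k₁, k₂ ∈ ℤ and all Schwartz functions f, g on I × ℝ²: ‖ f g ‖_{S_{max(k₁,k₂)}(t₀)} ≤ C ‖ f ‖_{S_{k₁}(t₀)} ‖ g ‖_{S_{k₂}(t₀)}. -/

import Mathlib

open MeasureTheory
open scoped RealInnerProductSpace

noncomputable section

/-- Euclidean plane `ℝ²` (frequency/space variable). -/
abbrev E2 := EuclideanSpace ℝ (Fin 2)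

/-- The hypotheses on the fixed Littlewood–Paley bump function `ϕ`: smooth, radial,
supported in `{|ξ| ≤ 11/10}` and equal to `1` on `{|ξ| ≤ 1}`. -/
def IsLPBump (ϕ : E2 → ℝ) : Prop :=
  ContDiff ℝ (⊤ : ℕ∞) ϕ ∧
  (∀ ξ : E2, 11 / 10 < ‖ξ‖ → ϕ ξ = 0) ∧
  (∀ ξ : E2, ‖ξ‖ ≤ 1 → ϕ ξ = 1) ∧
  (∀ ξ η : E2, ‖ξ‖ = ‖η‖ → ϕ ξ = ϕ η)

/-- The inverse Fourier transform `m̌(x) = ∫ m(ξ) e^{2πi⟨ξ,x⟩} dξ` on `ℝ²`. -/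
def invFT (m : E2 → ℂ) (x : E2) : ℂ :=
  ∫ ξ : E2, m ξ * Complex.exp (2 * Real.pi * Complex.I * (⟪ξ, x⟫ : ℝ))

/-- The Littlewood–Paley symbol `ϕ(ξ/2^k) − ϕ(2ξ/2^k)` of the projection `P_k`. -/
def lpSymb (ϕ : E2 → ℝ) (k : ℤ) (ξ : E2) : ℝ :=
  ϕ ((2 : ℝ) ^ (-k) • ξ) - ϕ ((2 : ℝ) ^ (1 - k) • ξ)

/-- The convolution kernel of the Littlewood–Paley projection `P_k`. -/
def lpKernel (ϕ : E2 → ℝ) (k : ℤ) (x : E2) : ℂ :=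
  invFT (fun ξ => (lpSymb ϕ k ξ : ℂ)) x

/-- The Littlewood–Paley projection `P_k f = κ_k ∗ f` of a function on `ℝ²`. -/
def lpProj (ϕ : E2 → ℝ) (k : ℤ) (f : E2 → ℝ) (x : E2) : ℂ :=
  ∫ y : E2, lpKernel ϕ k (x - y) * (f y : ℂ)

/-- The time derivative `∂ₜ` of a function on `ℝ × ℝ²`. -/
def dT (f : ℝ × E2 → ℝ) (p : ℝ × E2) : ℝ := fderiv ℝ f p (1, 0)

/-- The spatial derivative `∂_{x_i}` of a function on `ℝ × ℝ²`. -/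
def dX (i : Fin 2) (f : ℝ × E2 → ℝ) (p : ℝ × E2) : ℝ :=
  fderiv ℝ f p (0, EuclideanSpace.single i 1)

/-- The spatial Laplacian `Δ = ∂_{x₁}² + ∂_{x₂}²` of a function on `ℝ × ℝ²`. -/
def lapX (f : ℝ × E2 → ℝ) (p : ℝ × E2) : ℝ := dX 0 (dX 0 f) p + dX 1 (dX 1 f) p

/-- `‖P_{k′} ∇_{t,x} f(t₀,·)‖_{L²_x(ℝ²)}`, the `L²` norm of the Littlewood–Paley piece of
the spacetime gradient at the fixed time `t₀`. -/
def gradLP2 (ϕ : E2 → ℝ) (k' : ℤ) (t₀ : ℝ) (f : ℝ × E2 → ℝ) : ℝ :=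
  Real.sqrt (∫ x : E2,
    (‖lpProj ϕ k' (fun y => dT f (t₀, y)) x‖ ^ 2
      + ‖lpProj ϕ k' (fun y => dX 0 f (t₀, y)) x‖ ^ 2
      + ‖lpProj ϕ k' (fun y => dX 1 f (t₀, y)) x‖ ^ 2))

/-- The Besov-type Littlewood–Paley seminorm
`‖f‖_{S_k(t₀)} = sup_{k′} 2^{δ₁|k−k′|} ‖P_{k′} ∇_{t,x} f(t₀,·)‖_{L²_x}`. -/
def besovS (δ₁ : ℝ) (ϕ : E2 → ℝ) (t₀ : ℝ) (k : ℤ) (f : ℝ × E2 → ℝ) : ℝ :=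
  ⨆ k' : ℤ, (2 : ℝ) ^ (δ₁ * ((k - k').natAbs : ℝ)) * gradLP2 ϕ k' t₀ f

/-- A Schwartz function on `I × ℝ²`: smooth, with every derivative rapidly decreasing in
`x` uniformly in `t ∈ I`. -/
def SchwartzOnI (I : Set ℝ) (f : ℝ × E2 → ℝ) : Prop :=
  ContDiff ℝ (⊤ : ℕ∞) f ∧
  ∀ n N : ℕ, ∃ C : ℝ, ∀ p : ℝ × E2, p.1 ∈ I →
    ‖p.2‖ ^ N * ‖iteratedFDeriv ℝ n f p‖ ≤ C

/-- A smooth curve `(0,∞) ∋ s ↦ u(s)` of Schwartz functions on `I × ℝ²`. -/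
def SmoothSchwartzCurve (I : Set ℝ) (u : ℝ → ℝ × E2 → ℝ) : Prop :=
  (∀ s : ℝ, 0 < s → SchwartzOnI I (u s)) ∧
  ContDiffOn ℝ (⊤ : ℕ∞) (fun q : ℝ × (ℝ × E2) => u q.1 q.2)
    (Set.Ioi 0 ×ˢ Set.univ)

open scoped ENNReal

/-- Dyadic annulus. -/
def ann (k : ℤ) : Set E2 := {ξ : E2 | (2 : ℝ) ^ k ≤ ‖ξ‖ ∧ ‖ξ‖ < (2 : ℝ) ^ (k + 1)}

lemma measurableSet_ann (k : ℤ) : MeasurableSet (ann k) :=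
  (measurableSet_le measurable_const measurable_norm).inter
    (measurableSet_lt measurable_norm measurable_const)

lemma cs_lintegral {α : Type*} [MeasurableSpace α] (μ : Measure α) {f g : α → ℝ≥0∞}
    (hf : AEMeasurable f μ) (hg : AEMeasurable g μ) :
    (∫⁻ a, f a * g a ∂μ) ^ 2 ≤ (∫⁻ a, f a ^ 2 ∂μ) * (∫⁻ a, g a ^ 2 ∂μ) := by
  have h := ENNReal.lintegral_mul_le_Lp_mul_Lq μ Real.HolderConjugate.two_two hf hg
  simp only [Pi.mul_apply, ENNReal.rpow_two] at h
  calc _ ≤ ((∫⁻ a, f a ^ 2 ∂μ) ^ (1 / (2:ℝ)) * (∫⁻ a, g a ^ 2 ∂μ) ^ (1 / (2:ℝ))) ^ 2 := by gcongr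
    _ = _ := by
      rw [mul_pow, ← ENNReal.rpow_two, ← ENNReal.rpow_two, ← ENNReal.rpow_mul, ← ENNReal.rpow_mul]
      norm_num

lemma cs_tsum {ι : Type*} (f g : ι → ℝ≥0∞) :
    (∑' i, f i * g i) ^ 2 ≤ (∑' i, f i ^ 2) * (∑' i, g i ^ 2) := by
  let _ : MeasurableSpace ι := ⊤
  have := cs_lintegral (Measure.count : Measure ι) (f := f) (g := g)
    (measurable_from_top).aemeasurable (measurable_from_top).aemeasurable
  simpa [lintegral_count] using this

lemma cs_tsum_weight {ι : Type*} (y w : ι → ℝ≥0∞) (h0 : ∀ i, w i ≠ 0) (ht : ∀ i, w i ≠ ⊤) :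
    (∑' i, y i) ^ 2 ≤ (∑' i, w i) * (∑' i, (w i)⁻¹ * y i ^ 2) := by
  have h := cs_tsum (fun i => w i ^ (1/2 : ℝ)) (fun i => (w i) ^ (-(1/2 : ℝ)) * y i)
  have e1 : ∀ i, w i ^ (1/2 : ℝ) * ((w i) ^ (-(1/2 : ℝ)) * y i) = y i := by
    intro i
    rw [← mul_assoc, ← ENNReal.rpow_add _ _ (h0 i) (ht i)]
    simp
  have e2 : ∀ i, (w i ^ (1/2 : ℝ)) ^ 2 = w i := by
    intro i
    rw [← ENNReal.rpow_two, ← ENNReal.rpow_mul]; norm_num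
  have e3 : ∀ i, ((w i) ^ (-(1/2 : ℝ)) * y i) ^ 2 = (w i)⁻¹ * y i ^ 2 := by
    intro i
    rw [mul_pow, ← ENNReal.rpow_two, ← ENNReal.rpow_mul]; norm_num
    rw [ENNReal.rpow_neg_one]
  simpa only [e1, e2, e3] using h

/-- powers of two in `ℝ≥0∞` -/
def tw (x : ℝ) : ℝ≥0∞ := (2 : ℝ≥0∞) ^ x

lemma tw_add (x y : ℝ) : tw (x + y) = tw x * tw y := ENNReal.rpow_add _ _ (by simp) (by simp)
lemma tw_ne_zero (x : ℝ) : tw x ≠ 0 := by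
  have : 0 < (2 : ℝ≥0∞) ^ x := ENNReal.rpow_pos (by simp) (by simp)
  exact this.ne'
lemma tw_ne_top (x : ℝ) : tw x ≠ ⊤ := ENNReal.rpow_ne_top_of_ne_zero (by simp) (by simp)
lemma tw_mono {x y : ℝ} (h : x ≤ y) : tw x ≤ tw y := ENNReal.rpow_le_rpow_of_exponent_le (by simp) h
lemma tw_zero : tw 0 = 1 := ENNReal.rpow_zero
lemma tw_sq (x : ℝ) : tw x ^ 2 = tw (2 * x) := by rw [sq, ← tw_add]; congr 1; ring
lemma tw_ofReal (x : ℝ) : tw x = ENNReal.ofReal ((2 : ℝ) ^ x) := by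
  rw [tw, ← ENNReal.ofReal_rpow_of_pos (by norm_num)]; norm_num
lemma tw_int (n : ℤ) : tw n = ENNReal.ofReal ((2 : ℝ) ^ n) := by
  rw [tw_ofReal, Real.rpow_intCast]

lemma volume_ann (k : ℤ) : volume (ann k) ≤ ENNReal.ofReal (4 * Real.pi) * tw (2 * k) := by
  calc volume (ann k) ≤ volume (Metric.ball (0 : E2) (2 ^ (k + 1))) := by
        apply measure_mono
        intro x hx
        simpa using hx.2
    _ = _ := by
        rw [EuclideanSpace.volume_ball_fin_two, ← tw_sq, tw_int, ← ENNReal.ofReal_pow (by positivity),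
          ← ENNReal.ofReal_mul (by positivity), ← ENNReal.ofReal_pow (by positivity)]
        rw [← ENNReal.ofReal_mul (by positivity), zpow_add₀ (by norm_num)]
        congr 1
        ring

lemma lconv_sq_aux {U V : E2 → ℝ≥0∞} (hU : Measurable U) (hV : Measurable V) :
    ∫⁻ ξ, ∫⁻ η, U (ξ - η) ^ 2 * V η ^ 2 = (∫⁻ ξ, U ξ ^ 2) * (∫⁻ ξ, V ξ ^ 2) := by
  rw [lintegral_lintegral_swap]
  · rw [mul_comm, ← lintegral_mul_const _ (by fun_prop)]
    congr 1
    ext η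
    rw [lintegral_mul_const _ (by fun_prop), mul_comm]
    congr 1
    exact lintegral_sub_right_eq_self (fun x => U x ^ 2) η
  · apply Measurable.aemeasurable
    fun_prop

/-- If `U, V` live on annuli `i, j`, the localized convolution satisfies the trilinear bound. -/
lemma bilin {U V : E2 → ℝ≥0∞} (hU : Measurable U) (hV : Measurable V) (i j k : ℤ)
    (hUs : ∀ ξ, ξ ∉ ann i → U ξ = 0) (hVs : ∀ ξ, ξ ∉ ann j → V ξ = 0) :
    ∫⁻ ξ in ann k, (∫⁻ η, U (ξ - η) * V η) ^ 2 ≤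
      ENNReal.ofReal (4 * Real.pi) * tw (2 * (min i (min j k) : ℤ)) *
        ((∫⁻ ξ, U ξ ^ 2) * (∫⁻ ξ, V ξ ^ 2)) := by
  have key : ∀ (c : ℝ≥0∞), (∀ ξ, ∃ S : Set E2, MeasurableSet S ∧ volume S ≤ c ∧
      ∀ η, η ∉ S → U (ξ - η) * V η = 0) →
      ∫⁻ ξ in ann k, (∫⁻ η, U (ξ - η) * V η) ^ 2 ≤ c * ((∫⁻ ξ, U ξ ^ 2) * (∫⁻ ξ, V ξ ^ 2)) := by
    intro c hc
    calc _ ≤ ∫⁻ ξ, (∫⁻ η, U (ξ - η) * V η) ^ 2 := setLIntegral_le_lintegral _ _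
      _ ≤ ∫⁻ ξ, c * ∫⁻ η, U (ξ - η) ^ 2 * V η ^ 2 := by
        apply lintegral_mono
        intro ξ
        obtain ⟨S, hS, hvol, hz⟩ := hc ξ
        have e : ∫⁻ η, U (ξ - η) * V η = ∫⁻ η, (S.indicator 1 η) * (U (ξ - η) * V η) := by
          congr 1; ext η
          by_cases h : η ∈ S
          · simp [h]
          · simp [h, hz η h]
        simp only
        rw [e]
        refine (cs_lintegral _ (measurable_one.indicator hS).aemeasurable
          (by fun_prop)).trans ?_
        gcongr
        · calc ∫⁻ a, S.indicator 1 a ^ 2 = ∫⁻ a, S.indicator (1 : E2 → ℝ≥0∞) a := by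
                congr 1; ext a; by_cases h : a ∈ S <;> simp [h]
            _ = volume S := lintegral_indicator_one hS
            _ ≤ c := hvol
        · exact (mul_pow _ _ _).le
      _ = _ := by
        rw [lintegral_const_mul, lconv_sq_aux hU hV]
        apply Measurable.lintegral_prod_right'
          (f := fun p : E2 × E2 => U (p.1 - p.2) ^ 2 * V p.2 ^ 2)
        fun_prop
  have hi : ∫⁻ ξ in ann k, (∫⁻ η, U (ξ - η) * V η) ^ 2 ≤
      ENNReal.ofReal (4 * Real.pi) * tw (2 * i) * ((∫⁻ ξ, U ξ ^ 2) * (∫⁻ ξ, V ξ ^ 2)) := by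
    apply key
    intro ξ
    refine ⟨(fun η => ξ - η) ⁻¹' ann i, (measurableSet_ann i).preimage (by fun_prop), ?_, ?_⟩
    · rw [(Measure.measurePreserving_sub_left volume ξ).measure_preimage
        (measurableSet_ann i).nullMeasurableSet]
      exact volume_ann i
    · intro η h
      rw [hUs _ h, zero_mul]
  have hj : ∫⁻ ξ in ann k, (∫⁻ η, U (ξ - η) * V η) ^ 2 ≤
      ENNReal.ofReal (4 * Real.pi) * tw (2 * j) * ((∫⁻ ξ, U ξ ^ 2) * (∫⁻ ξ, V ξ ^ 2)) := by
    apply key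
    intro ξ
    refine ⟨ann j, measurableSet_ann j, volume_ann j, ?_⟩
    · intro η h
      rw [hVs _ h, mul_zero]
  have hk : ∫⁻ ξ in ann k, (∫⁻ η, U (ξ - η) * V η) ^ 2 ≤
      ENNReal.ofReal (4 * Real.pi) * tw (2 * k) * ((∫⁻ ξ, U ξ ^ 2) * (∫⁻ ξ, V ξ ^ 2)) := by
    calc _ ≤ ∫⁻ ξ in ann k, ((∫⁻ ξ, U ξ ^ 2) * (∫⁻ ξ, V ξ ^ 2)) := by
          apply lintegral_mono
          intro ξ
          refine (cs_lintegral _ (by fun_prop) (by fun_prop)).trans ?_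
          exact mul_le_mul' (lintegral_sub_left_eq_self (fun x => U x ^ 2) ξ).le le_rfl
      _ = volume (ann k) * ((∫⁻ ξ, U ξ ^ 2) * (∫⁻ ξ, V ξ ^ 2)) := by
          rw [setLIntegral_const, mul_comm]
      _ ≤ _ := by gcongr; exact volume_ann k
  rcases min_choice j k with h | h <;> rw [h]
  · rcases min_choice i j with h | h <;> rw [h] <;> assumption
  · rcases min_choice i k with h | h <;> rw [h] <;> assumption

lemma norm_compat {x y z : E2} (h : x = y + z) {a b c : ℤ} (hx : x ∈ ann a) (hy : y ∈ ann b)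
    (hz : z ∈ ann c) : a ≤ max b c + 1 := by
  by_contra! hlt
  have h1 : ‖x‖ ≤ ‖y‖ + ‖z‖ := h ▸ norm_add_le y z
  have h2 : (2 : ℝ) ^ (b + 1) ≤ 2 ^ (a - 1) := zpow_le_zpow_right₀ (by norm_num) (by
    have := le_max_left b c; omega)
  have h3 : (2 : ℝ) ^ (c + 1) ≤ 2 ^ (a - 1) := zpow_le_zpow_right₀ (by norm_num) (by
    have := le_max_right b c; omega)
  have h4 : (2 : ℝ) ^ a = 2 ^ (a - 1) + 2 ^ (a - 1) := by
    rw [← two_mul, mul_comm, ← zpow_add_one₀ (by norm_num)]; simp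
  linarith [hx.1, hy.2, hz.2]

/-- The summation exponents. -/
lemma exponent_bound {δ : ℝ} (h0 : 0 < δ) (h1 : δ ≤ 1 / 100) (i j k k₁ k₂ : ℤ)
    (hk : k ≤ max i j + 1) (hi : i ≤ max k j + 1) (hj : j ≤ max k i + 1) :
    (min i (min j k) : ℤ) - (j : ℝ) - δ * (k₁ - i).natAbs - δ * (k₂ - j).natAbs ≤
      4 - δ * (max k₁ k₂ - k).natAbs - (k - i).natAbs / 4 - δ * (k - j).natAbs ∨
    (min i (min j k) : ℤ) - (j : ℝ) - δ * (k₁ - i).natAbs - δ * (k₂ - j).natAbs ≤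
      4 - δ * (max k₁ k₂ - k).natAbs - (k - i).natAbs / 4 - δ * (k₂ - j).natAbs := by
  have hD : (max k₁ k₂ - k).natAbs ≤ (k₁ - i).natAbs + (k - i).natAbs ∨
      (max k₁ k₂ - k).natAbs = (k₂ - k).natAbs ∧ k < k₂ := by omega
  have hD2 : (max k₁ k₂ - k).natAbs ≤ (k₁ - i).natAbs + (k₂ - j).natAbs + (k - i).natAbs +
    (k - j).natAbs := by omega
  have hM0 : min i (min j k) ≤ j := by omega
  have hM0' : ((min i (min j k) : ℤ) : ℝ) ≤ j := by exact_mod_cast hM0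
  by_cases hc : j + 2 ≤ k
  · have hR : (k - i).natAbs ≤ 1 := by omega
    have hR' : ((k - i).natAbs : ℝ) ≤ 1 := by exact_mod_cast hR
    rcases hD with hD | ⟨hD, hlt⟩
    · right
      have hD' : ((max k₁ k₂ - k).natAbs : ℝ) ≤ (k₁ - i).natAbs + (k - i).natAbs := by
        exact_mod_cast hD
      have := mul_le_mul_of_nonneg_left hD' h0.le
      have := mul_le_mul_of_nonneg_left hR' h0.le
      linarith
    · left
      have hQ : (max k₁ k₂ - k).natAbs + (k - j).natAbs = (k₂ - j).natAbs := by omega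
      have hQ' : ((max k₁ k₂ - k).natAbs : ℝ) + (k - j).natAbs = (k₂ - j).natAbs := by
        exact_mod_cast hQ
      rw [← hQ']
      have : 0 ≤ δ * ((k₁ - i).natAbs : ℝ) := by positivity
      linarith
  · left
    have hM : 2 * (min i (min j k) - j) + (k - i).natAbs + (k - j).natAbs ≤ 6 := by omega
    have hM' : 2 * (((min i (min j k) : ℤ) : ℝ) - j) + (k - i).natAbs + (k - j).natAbs ≤ 6 := by
      generalize (k - i).natAbs = R at hM ⊢
      generalize (k - j).natAbs = T at hM ⊢
      generalize min i (min j k) = M at hM ⊢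
      exact_mod_cast hM
    have hD' : ((max k₁ k₂ - k).natAbs : ℝ) ≤ (k₁ - i).natAbs + (k₂ - j).natAbs +
      (k - i).natAbs + (k - j).natAbs := by exact_mod_cast hD2
    have := mul_le_mul_of_nonneg_left hD' h0.le
    have := mul_le_mul_of_nonneg_right h1 (Nat.cast_nonneg (α := ℝ) (k - i).natAbs)
    have := mul_le_mul_of_nonneg_right h1 (Nat.cast_nonneg (α := ℝ) (k - j).natAbs)
    have := Nat.cast_nonneg (α := ℝ) (k - i).natAbs
    have := Nat.cast_nonneg (α := ℝ) (k - j).natAbs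
    linarith

/-- The summation weights. -/
def wt (δ : ℝ) (k k₂ : ℤ) (p : ℤ × ℤ) : ℝ≥0∞ :=
  tw (-((k - p.1).natAbs / 4)) * (tw (-(δ * (k - p.2).natAbs)) + tw (-(δ * (k₂ - p.2).natAbs)))

lemma wt_ne_zero (δ : ℝ) (k k₂ : ℤ) (p : ℤ × ℤ) : wt δ k k₂ p ≠ 0 := by
  simp [wt, tw_ne_zero]
lemma wt_ne_top (δ : ℝ) (k k₂ : ℤ) (p : ℤ × ℤ) : wt δ k k₂ p ≠ ⊤ :=
  ENNReal.mul_ne_top (tw_ne_top _) (ENNReal.add_ne_top.2 ⟨tw_ne_top _, tw_ne_top _⟩)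

/-- The geometric sum. -/
def geo (c : ℝ) : ℝ≥0∞ := ∑' n : ℤ, tw (-(c * n.natAbs))

lemma geo_sub (c : ℝ) (k : ℤ) : ∑' n : ℤ, tw (-(c * (k - n).natAbs)) = geo c :=
  (Equiv.subLeft k).tsum_eq (fun n : ℤ => tw (-(c * n.natAbs)))

lemma geo_ne_top {c : ℝ} (hc : 0 < c) : geo c ≠ ⊤ := by
  have hs : Summable (fun n : ℤ => (2 : ℝ) ^ (-(c * n.natAbs))) := by
    have hg : Summable (fun n : ℕ => (2 : ℝ) ^ (-(c * n))) := by
      have : ∀ n : ℕ, (2 : ℝ) ^ (-(c * n)) = ((2 : ℝ) ^ (-c)) ^ n := by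
        intro n
        rw [← Real.rpow_natCast, ← Real.rpow_mul (by norm_num)]
        congr 1; ring
      simp_rw [this]
      exact summable_geometric_of_lt_one (by positivity)
        (Real.rpow_lt_one_of_one_lt_of_neg (by norm_num) (by linarith))
    apply Summable.of_nat_of_neg <;> simpa using hg
  have := hs.tsum_ofReal_ne_top
  simpa [geo, tw_ofReal] using this

lemma tsum_wt (δ : ℝ) (k k₂ : ℤ) : ∑' p, wt δ k k₂ p = geo (1/4) * (2 * geo δ) := by
  rw [ENNReal.tsum_prod']
  simp only [wt]
  simp_rw [ENNReal.tsum_mul_left, ENNReal.tsum_mul_right, ENNReal.tsum_add, geo_sub]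
  rw [← geo_sub (1/4) k, two_mul]
  congr 2
  ext n; congr 2; ring

lemma tw_exponent_bound {δ : ℝ} (h0 : 0 < δ) (h1 : δ ≤ 1 / 100) (i j k k₁ k₂ : ℤ)
    (hk : k ≤ max i j + 1) (hi : i ≤ max k j + 1) (hj : j ≤ max k i + 1) :
    tw ((min i (min j k) : ℤ) - (j : ℝ) - δ * (k₁ - i).natAbs - δ * (k₂ - j).natAbs) ≤
      tw 4 * tw (- (δ * (max k₁ k₂ - k).natAbs)) * wt δ k k₂ (i, j) := by
  rcases exponent_bound h0 h1 i j k k₁ k₂ hk hi hj with h | h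
  · refine (tw_mono h).trans ?_
    calc _ = tw 4 * tw (- (δ * (max k₁ k₂ - k).natAbs)) * (tw (-((k - i).natAbs / 4)) *
          tw (-(δ * (k - j).natAbs))) := by
            rw [← tw_add, ← tw_add, ← tw_add]; congr 1; ring
      _ ≤ _ := by unfold wt; gcongr; exact le_self_add
  · refine (tw_mono h).trans ?_
    calc _ = tw 4 * tw (- (δ * (max k₁ k₂ - k).natAbs)) * (tw (-((k - i).natAbs / 4)) *
          tw (-(δ * (k₂ - j).natAbs))) := by
            rw [← tw_add, ← tw_add, ← tw_add]; congr 1; ring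
      _ ≤ _ := by unfold wt; gcongr; exact le_add_self

lemma exists_ann {ξ : E2} (h : ξ ≠ 0) : ∃ k, ξ ∈ ann k := by
  obtain ⟨n, hn⟩ := exists_mem_Ico_zpow (norm_pos_iff.2 h) (one_lt_two (α := ℝ))
  exact ⟨n, hn.1, hn.2⟩

/-- Core convolution estimate on the Fourier side. -/
lemma core {δ : ℝ} (h0 : 0 < δ) (h1 : δ ≤ 1 / 100) {U V : E2 → ℝ≥0∞}
    (hU : Measurable U) (hV : Measurable V) (A B : ℝ≥0∞) (k₁ k₂ : ℤ)
    (hA : ∀ i, ∫⁻ ξ in ann i, U ξ ^ 2 ≤ (A * tw (-(δ * (k₁ - i).natAbs))) ^ 2)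
    (hB : ∀ i, ∫⁻ ξ in ann i, V ξ ^ 2 ≤ (B * tw (-(δ * (k₂ - i).natAbs))) ^ 2) (k : ℤ) :
    ∫⁻ ξ in ann k, (∫⁻ η, U (ξ - η) * (V η * ENNReal.ofReal ‖η‖⁻¹)) ^ 2 ≤
      ENNReal.ofReal (4 * Real.pi) * (tw 4 * geo (1/4) * (2 * geo δ)) ^ 2 *
        (A * B * tw (-(δ * (max k₁ k₂ - k).natAbs))) ^ 2 := by
  set Ui : ℤ → E2 → ℝ≥0∞ := fun i => (ann i).indicator U with hUi
  set Vj : ℤ → E2 → ℝ≥0∞ := fun j => (ann j).indicator V with hVj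
  have mU : ∀ i, Measurable (Ui i) := fun i => hU.indicator (measurableSet_ann i)
  have mV : ∀ i, Measurable (Vj i) := fun i => hV.indicator (measurableSet_ann i)
  set y : ℤ × ℤ → E2 → ℝ≥0∞ := fun p ξ => tw (-p.2) * ∫⁻ η, Ui p.1 (ξ - η) * Vj p.2 η with hy
  have my : ∀ p, Measurable (y p) := by
    intro p
    apply Measurable.const_mul
    apply Measurable.lintegral_prod_right'
      (f := fun q : E2 × E2 => Ui p.1 (q.1 - q.2) * Vj p.2 q.2)
    have := mU p.1
    have := mV p.2
    fun_prop
  have hle : ∀ ξ, ∫⁻ η, U (ξ - η) * (V η * ENNReal.ofReal ‖η‖⁻¹) ≤ ∑' p, y p ξ := by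
    intro ξ
    simp only [hy]
    have : ∀ p : ℤ × ℤ, tw (-p.2) * ∫⁻ η, Ui p.1 (ξ - η) * Vj p.2 η =
        ∫⁻ η, tw (-p.2) * (Ui p.1 (ξ - η) * Vj p.2 η) := by
      intro p
      have := mU p.1
      have := mV p.2
      rw [lintegral_const_mul _ (by fun_prop)]
    simp_rw [this]
    rw [← lintegral_tsum]
    · apply lintegral_mono_ae
      have n1 : ∀ᵐ η : E2, η ≠ 0 := Measure.ae_ne volume 0
      have n2 : ∀ᵐ η : E2, η ≠ ξ := Measure.ae_ne volume ξ
      filter_upwards [n1, n2] with η h1 h2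
      obtain ⟨j, hj⟩ := exists_ann h1
      obtain ⟨i, hi⟩ := exists_ann (sub_ne_zero.2 h2.symm)
      refine le_trans ?_ (ENNReal.le_tsum (i, j))
      simp only [hUi, hVj, Set.indicator_of_mem hi, Set.indicator_of_mem hj]
      have : ENNReal.ofReal ‖η‖⁻¹ ≤ tw (-j) := by
        have := tw_int (-j)
        push_cast at this
        rw [this]
        apply ENNReal.ofReal_le_ofReal
        rw [zpow_neg]
        exact inv_anti₀ (by positivity) hj.1
      calc _ ≤ U (ξ - η) * (V η * tw (-j)) := by gcongr
        _ = _ := by ring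
    · intro p
      have := mU p.1
      have := mV p.2
      fun_prop
  set K : ℝ≥0∞ := ENNReal.ofReal (4 * Real.pi) * (A * B * tw 4 *
    tw (-(δ * (max k₁ k₂ - k).natAbs))) ^ 2 with hK
  have hyb : ∀ p, ∫⁻ ξ in ann k, y p ξ ^ 2 ≤ K * wt δ k k₂ p ^ 2 := by
    rintro ⟨i, j⟩
    by_cases hc : k ≤ max i j + 1 ∧ i ≤ max k j + 1 ∧ j ≤ max k i + 1
    · have hb := bilin (mU i) (mV j) i j k (fun ξ h => by simp [hUi, h])
        (fun ξ h => by simp [hVj, h])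
      have eU : ∫⁻ ξ, Ui i ξ ^ 2 = ∫⁻ ξ in ann i, U ξ ^ 2 := by
        rw [← lintegral_indicator (measurableSet_ann i)]
        congr 1; ext ξ
        by_cases h : ξ ∈ ann i <;> simp [hUi, h]
      have eV : ∫⁻ ξ, Vj j ξ ^ 2 = ∫⁻ ξ in ann j, V ξ ^ 2 := by
        rw [← lintegral_indicator (measurableSet_ann j)]
        congr 1; ext ξ
        by_cases h : ξ ∈ ann j <;> simp [hVj, h]
      rw [eU, eV] at hb
      simp only [hy, mul_pow]
      rw [lintegral_const_mul']
      swap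
      · exact ENNReal.pow_ne_top (tw_ne_top _)
      calc _ ≤ tw (-j) ^ 2 * (ENNReal.ofReal (4 * Real.pi) * tw (2 * (min i (min j k) : ℤ)) *
            ((A * tw (-(δ * (k₁ - i).natAbs))) ^ 2 * (B * tw (-(δ * (k₂ - j).natAbs))) ^ 2)) := by
              gcongr
              refine hb.trans ?_
              gcongr
              · exact hA i
              · exact hB j
        _ = ENNReal.ofReal (4 * Real.pi) * (A * B * tw ((min i (min j k) : ℤ) - (j : ℝ) -
              δ * (k₁ - i).natAbs - δ * (k₂ - j).natAbs)) ^ 2 := by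
              rw [← tw_sq]
              simp only [sub_eq_add_neg, tw_add]
              ring
        _ ≤ ENNReal.ofReal (4 * Real.pi) * (A * B * (tw 4 * tw (- (δ * (max k₁ k₂ - k).natAbs)) *
              wt δ k k₂ (i, j))) ^ 2 := by
              gcongr
              exact tw_exponent_bound h0 h1 i j k k₁ k₂ hc.1 hc.2.1 hc.2.2
        _ = _ := by simp only [hK]; ring
    · refine le_of_eq_of_le ?_ zero_le
      rw [setLIntegral_eq_zero (measurableSet_ann k)]
      intro ξ hξ
      have : ∀ η, Ui i (ξ - η) * Vj j η = 0 := by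
        intro η
        by_cases a1 : ξ - η ∈ ann i
        · by_cases a2 : η ∈ ann j
          · exfalso
            apply hc
            have neg : ∀ {x : E2} {n : ℤ}, x ∈ ann n → -x ∈ ann n := by
              intro x n hx; simpa [ann] using hx
            refine ⟨norm_compat (y := ξ - η) (z := η) (by simp) hξ a1 a2,
              norm_compat (y := ξ) (z := -η) (by abel) a1 hξ (neg a2),
              norm_compat (y := ξ) (z := -(ξ - η)) (by abel) a2 hξ (neg a1)⟩
          · simp [hVj, a2]
        · simp [hUi, a1]
      simp [hy, this]
  calc _ ≤ ∫⁻ ξ in ann k, (∑' p, y p ξ) ^ 2 := by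
        apply lintegral_mono
        intro ξ
        simp only
        gcongr
        exact hle ξ
    _ ≤ ∫⁻ ξ in ann k, (∑' p, wt δ k k₂ p) * (∑' p, (wt δ k k₂ p)⁻¹ * y p ξ ^ 2) := by
        apply lintegral_mono
        intro ξ
        exact cs_tsum_weight _ _ (wt_ne_zero δ k k₂) (wt_ne_top δ k k₂)
    _ = (∑' p, wt δ k k₂ p) * (∑' p, (wt δ k k₂ p)⁻¹ * ∫⁻ ξ in ann k, y p ξ ^ 2) := by
        rw [lintegral_const_mul, lintegral_tsum]
        · congr 2; ext p
          rw [lintegral_const_mul]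
          exact (my p).pow_const 2
        · intro p
          exact (((my p).pow_const 2).const_mul _).aemeasurable
        · apply Measurable.tsum
          intro p
          exact (((my p).pow_const 2).const_mul _)
    _ ≤ (∑' p, wt δ k k₂ p) * (∑' p, (wt δ k k₂ p)⁻¹ * (K * wt δ k k₂ p ^ 2)) := by
        gcongr with p
        exact hyb p
    _ = (∑' p, wt δ k k₂ p) * (∑' p, K * wt δ k k₂ p) := by
        congr 2; ext p
        rw [sq, ← mul_assoc K, mul_comm, mul_assoc, ENNReal.mul_inv_cancel (wt_ne_zero _ _ _ _)
          (wt_ne_top _ _ _ _), mul_one]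
    _ = _ := by
        rw [ENNReal.tsum_mul_left, tsum_wt, hK]
        ring

open scoped FourierTransform SchwartzMap LineDeriv Convolution

lemma symb_zero {ϕ : E2 → ℝ} (hϕ : IsLPBump ϕ) (k : ℤ) {ξ : E2} (h1 : ξ ∉ ann (k - 1))
    (h2 : ξ ∉ ann k) : lpSymb ϕ k ξ = 0 := by
  obtain ⟨-, hz, ho, -⟩ := hϕ
  have e0 : (2 : ℝ) ^ (-k) * 2 ^ k = 1 := by rw [← zpow_add₀ (by norm_num)]; simp
  have e1 : (2 : ℝ) ^ (1 - k) = 2 * 2 ^ (-k) := by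
    rw [sub_eq_add_neg, zpow_add₀ (by norm_num)]; simp
  have p : (0 : ℝ) < 2 ^ (-k) := by positivity
  have e2 : (2 : ℝ) ^ (k - 1) = 2 ^ k / 2 := zpow_sub_one₀ (by norm_num) k
  have e3 : (2 : ℝ) ^ (k + 1) = 2 ^ k * 2 := zpow_add_one₀ (by norm_num) k
  have p' : (0 : ℝ) < 2 ^ k := by positivity
  simp only [ann, Set.mem_ofPred_eq, not_and, not_lt, sub_add_cancel] at h1 h2
  unfold lpSymb
  by_cases h : ‖ξ‖ < 2 ^ (k - 1)
  · have := mul_lt_mul_of_pos_left h p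
    rw [ho, ho, sub_self]
    · rw [norm_smul, Real.norm_of_nonneg (by positivity), e1]
      rw [e2] at this; nlinarith
    · rw [norm_smul, Real.norm_of_nonneg (by positivity)]
      rw [e2] at this; nlinarith
  · have h3 := h2 (h1 (not_lt.1 h))
    have := mul_le_mul_of_nonneg_left h3 p.le
    rw [e3] at this
    rw [hz, hz, sub_self]
    · rw [norm_smul, Real.norm_of_nonneg (by positivity), e1]
      nlinarith
    · rw [norm_smul, Real.norm_of_nonneg (by positivity)]
      nlinarith

lemma symb_one {ϕ : E2 → ℝ} (hϕ : IsLPBump ϕ) (k : ℤ) {ξ : E2} (h : ξ ∈ ann k) :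
    lpSymb ϕ k ξ + lpSymb ϕ (k + 1) ξ = 1 := by
  obtain ⟨-, hz, ho, -⟩ := hϕ
  have e0 : (2 : ℝ) ^ (-k) * 2 ^ k = 1 := by rw [← zpow_add₀ (by norm_num)]; simp
  have e1 : (2 : ℝ) ^ (1 - k) = 2 * 2 ^ (-k) := by
    rw [sub_eq_add_neg, zpow_add₀ (by norm_num)]; simp
  have e3 : (2 : ℝ) ^ (k + 1) = 2 ^ k * 2 := zpow_add_one₀ (by norm_num) k
  have e4 : (2 : ℝ) ^ (-(k + 1)) = 2 ^ (-k) / 2 := by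
    rw [neg_add, ← sub_eq_add_neg, zpow_sub_one₀ (by norm_num)]; rfl
  have e5 : 1 - (k + 1) = -k := by ring
  have p : (0 : ℝ) < 2 ^ (-k) := by positivity
  unfold lpSymb
  have a1 := mul_le_mul_of_nonneg_left h.1 p.le
  have a2 := mul_lt_mul_of_pos_left h.2 p
  rw [e3] at a2
  rw [e5, hz ((2 : ℝ) ^ (1 - k) • ξ), ho ((2 : ℝ) ^ (-(k + 1)) • ξ)]
  · ring
  · rw [norm_smul, Real.norm_of_nonneg (by positivity), e4]; nlinarith
  · rw [norm_smul, Real.norm_of_nonneg (by positivity), e1]; nlinarith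

lemma bump_compact {ϕ : E2 → ℝ} (hϕ : IsLPBump ϕ) : HasCompactSupport ϕ := by
  apply HasCompactSupport.of_support_subset_isCompact (isCompact_closedBall (0 : E2) (11/10))
  intro x hx
  by_contra h
  simp at h
  exact hx (hϕ.2.1 x h)

lemma symb_bound {ϕ : E2 → ℝ} (hϕ : IsLPBump ϕ) : ∃ M : ℝ, 0 < M ∧ ∀ k ξ, |lpSymb ϕ k ξ| ≤ M := by
  obtain ⟨C, hC⟩ := (bump_compact hϕ).exists_bound_of_continuous hϕ.1.continuous
  refine ⟨2 * C + 1, ?_, ?_⟩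
  · have := (norm_nonneg _).trans (hC 0); linarith
  · intro k ξ
    unfold lpSymb
    have a := hC ((2 : ℝ) ^ (-k) • ξ)
    have b := hC ((2 : ℝ) ^ (1 - k) • ξ)
    rw [Real.norm_eq_abs] at a b
    have := abs_sub (ϕ ((2 : ℝ) ^ (-k) • ξ)) (ϕ ((2 : ℝ) ^ (1 - k) • ξ))
    linarith

lemma symb_smooth {ϕ : E2 → ℝ} (hϕ : IsLPBump ϕ) (k : ℤ) :
    ContDiff ℝ (⊤ : ℕ∞) (fun ξ => (lpSymb ϕ k ξ : ℂ)) := by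
  have := hϕ.1
  have h : ContDiff ℝ (⊤ : ℕ∞) (fun ξ => lpSymb ϕ k ξ) := by
    unfold lpSymb
    fun_prop
  exact Complex.ofRealCLM.contDiff.comp h

lemma symb_compact {ϕ : E2 → ℝ} (hϕ : IsLPBump ϕ) (k : ℤ) :
    HasCompactSupport (fun ξ => (lpSymb ϕ k ξ : ℂ)) := by
  apply HasCompactSupport.of_support_subset_isCompact
    (isCompact_closedBall (0 : E2) (2 ^ (k + 1)))
  intro x hx
  by_contra h
  apply hx
  simp only [Metric.mem_closedBall, dist_zero_right, not_le] at h
  simp only [Complex.ofReal_eq_zero]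
  apply symb_zero hϕ
  · intro h'
    have := h'.2
    have : (2 : ℝ) ^ (k - 1 + 1) ≤ 2 ^ (k + 1) := zpow_le_zpow_right₀ (by norm_num) (by omega)
    linarith
  · intro h'
    exact lt_asymm h h'.2

/-- The symbol as a Schwartz function. -/
def psiS {ϕ : E2 → ℝ} (hϕ : IsLPBump ϕ) (k : ℤ) : 𝓢(E2, ℂ) :=
  (symb_compact hϕ k).toSchwartzMap (symb_smooth hϕ k)

lemma psiS_apply {ϕ : E2 → ℝ} (hϕ : IsLPBump ϕ) (k : ℤ) (ξ : E2) :
    psiS hϕ k ξ = (lpSymb ϕ k ξ : ℂ) := rfl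

lemma lpKernel_eq {ϕ : E2 → ℝ} (hϕ : IsLPBump ϕ) (k : ℤ) (x : E2) :
    lpKernel ϕ k x = 𝓕⁻ (psiS hϕ k) x := by
  rw [SchwartzMap.fourierInv_coe, Real.fourierInv_eq']
  unfold lpKernel invFT
  congr 1
  ext ξ
  rw [psiS_apply, smul_eq_mul, mul_comm]
  congr 2
  push_cast
  ring

lemma lpProj_eq {ϕ : E2 → ℝ} (hϕ : IsLPBump ϕ) (k : ℤ) (h : E2 → ℝ) (S : 𝓢(E2, ℂ))
    (hS : ∀ y, S y = (h y : ℂ)) (x : E2) :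
    lpProj ϕ k h x = SchwartzMap.convolution (ContinuousLinearMap.mul ℂ ℂ) S (𝓕⁻ (psiS hϕ k)) x := by
  rw [SchwartzMap.convolution_apply, convolution_def]
  unfold lpProj
  congr 1
  ext y
  rw [lpKernel_eq hϕ, hS, ContinuousLinearMap.mul_apply', mul_comm]

lemma schwartz_sq_integrable (F : 𝓢(E2, ℂ)) : Integrable (fun x => ‖F x‖ ^ 2) :=
  (F.memLp 2).integrable_norm_pow (by norm_num)

lemma ofReal_integral_sq (F : 𝓢(E2, ℂ)) :
    ENNReal.ofReal (∫ x, ‖F x‖ ^ 2) = ∫⁻ x, ‖F x‖ₑ ^ 2 := by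
  rw [ofReal_integral_eq_lintegral_ofReal (schwartz_sq_integrable F)
    (Filter.Eventually.of_forall fun x => by positivity)]
  congr 1
  ext x
  rw [ENNReal.ofReal_pow (by positivity), ofReal_norm]

lemma lpProj_plancherel {ϕ : E2 → ℝ} (hϕ : IsLPBump ϕ) (k : ℤ) (h : E2 → ℝ) (S : 𝓢(E2, ℂ))
    (hS : ∀ y, S y = (h y : ℂ)) :
    Integrable (fun x => ‖lpProj ϕ k h x‖ ^ 2) ∧
    ENNReal.ofReal (∫ x, ‖lpProj ϕ k h x‖ ^ 2) =
      ∫⁻ ξ, (‖lpSymb ϕ k ξ‖ₑ * ‖𝓕 S ξ‖ₑ) ^ 2 := by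
  simp_rw [lpProj_eq hϕ k h S hS]
  refine ⟨schwartz_sq_integrable _, ?_⟩
  rw [← SchwartzMap.integral_norm_sq_fourier, ofReal_integral_sq]
  congr 1
  ext ξ
  rw [SchwartzMap.fourier_convolution, SchwartzMap.pairing_apply_apply,
    ContinuousLinearMap.mul_apply', enorm_mul, mul_comm, FourierTransform.fourier_fourierInv_eq,
    psiS_apply]
  congr 2
  rw [← ofReal_norm, ← ofReal_norm]; simp

/-- Fourier transform of a product. -/
lemma fourier_mul_le (a b : 𝓢(E2, ℂ)) (ξ : E2) :
    ‖𝓕 (SchwartzMap.pairing (ContinuousLinearMap.mul ℂ ℂ) a b) ξ‖ₑ ≤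
      ∫⁻ η, ‖𝓕 a (ξ - η)‖ₑ * ‖𝓕 b η‖ₑ := by
  set m := ContinuousLinearMap.mul ℂ ℂ
  have h1 : SchwartzMap.pairing m a b = 𝓕⁻ (SchwartzMap.convolution m (𝓕 b) (𝓕 a)) := by
    ext x
    rw [SchwartzMap.fourierInv_coe, Real.fourierInv_eq_fourier_neg, ← SchwartzMap.fourier_coe,
      SchwartzMap.fourier_convolution, SchwartzMap.pairing_apply_apply,
      SchwartzMap.pairing_apply_apply, SchwartzMap.fourier_coe (𝓕 b), SchwartzMap.fourier_coe (𝓕 a),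
      ← Real.fourierInv_eq_fourier_neg, ← Real.fourierInv_eq_fourier_neg,
      ← SchwartzMap.fourierInv_coe, ← SchwartzMap.fourierInv_coe]
    simp [m, mul_comm]
  rw [h1, FourierTransform.fourier_fourierInv_eq, SchwartzMap.convolution_apply, convolution_def]
  refine (enorm_integral_le_lintegral_enorm _).trans ?_
  apply lintegral_mono
  intro η
  simp [m, enorm_mul, mul_comm]

/-- Slices of Schwartz functions on `I × ℝ²`. -/
def slice {I : Set ℝ} {f : ℝ × E2 → ℝ} (hf : SchwartzOnI I f) {t₀ : ℝ} (ht : t₀ ∈ I) :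
    𝓢(E2, ℂ) where
  toFun y := (f (t₀, y) : ℂ)
  smooth' := by
    have := hf.1
    apply Complex.ofRealCLM.contDiff.comp
    fun_prop
  decay' N n := by
    obtain ⟨C, hC⟩ := hf.2 n N
    refine ⟨C, fun y => ?_⟩
    refine le_trans ?_ (hC (t₀, y) ht)
    gcongr
    have e1 : (fun y : E2 => (f (t₀, y) : ℂ)) = Complex.ofRealLI ∘ (fun y => f (t₀, y)) := rfl
    have hs : ContDiff ℝ (⊤ : ℕ∞) (fun y : E2 => f (t₀, y)) := by
      have := hf.1
      fun_prop
    rw [e1, Complex.ofRealLI.norm_iteratedFDeriv_comp_left hs.contDiffAt (mod_cast le_top)]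
    have e2 : (fun y : E2 => f (t₀, y)) =
        (fun p => f (p + (t₀, 0))) ∘ (ContinuousLinearMap.inr ℝ ℝ E2) := by
      ext y; simp
    rw [e2, ContinuousLinearMap.iteratedFDeriv_comp_right _ (n := (⊤ : ℕ∞)) _ _ (mod_cast le_top),
      iteratedFDeriv_comp_add_right]
    swap
    · have := hf.1
      fun_prop
    refine (ContinuousMultilinearMap.norm_compContinuousLinearMap_le _ _).trans ?_
    simp only [ContinuousLinearMap.inr_apply, Prod.mk_add_mk, zero_add, add_zero,
      Finset.prod_const]
    refine mul_le_of_le_one_right (by positivity) (pow_le_one₀ (by positivity) ?_)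
    exact ContinuousLinearMap.norm_inr_le_one ℝ ℝ E2

lemma schwartzOnI_fderiv {I : Set ℝ} {f : ℝ × E2 → ℝ} (hf : SchwartzOnI I f) (v : ℝ × E2) :
    SchwartzOnI I (fun p => fderiv ℝ f p v) := by
  have hd : ContDiff ℝ (⊤ : ℕ∞) (fderiv ℝ f) := hf.1.fderiv_right (by simp)
  refine ⟨hd.clm_apply contDiff_const, fun n N => ?_⟩
  obtain ⟨C, hC⟩ := hf.2 (n + 1) N
  refine ⟨‖v‖ * C, fun p hp => ?_⟩
  calc _ ≤ ‖p.2‖ ^ N * (‖v‖ * ‖iteratedFDeriv ℝ n (fderiv ℝ f) p‖) := by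
        gcongr
        exact norm_iteratedFDeriv_clm_apply_const (N := (⊤ : ℕ∞)) hd.contDiffAt (mod_cast le_top)
    _ = ‖v‖ * (‖p.2‖ ^ N * ‖iteratedFDeriv ℝ (n + 1) f p‖) := by
        rw [norm_iteratedFDeriv_fderiv]; ring
    _ ≤ _ := by gcongr; exact hC p hp

/-- The directions of differentiation. -/
def dirs : Fin 3 → ℝ × E2 :=
  ![(1, 0), (0, EuclideanSpace.single 0 1), (0, EuclideanSpace.single 1 1)]

/-- The Schwartz components of the spacetime gradient at time `t₀`. -/
def dS {I : Set ℝ} {f : ℝ × E2 → ℝ} (hf : SchwartzOnI I f) {t₀ : ℝ} (ht : t₀ ∈ I) (c : Fin 3) :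
    𝓢(E2, ℂ) := slice (schwartzOnI_fderiv hf (dirs c)) ht

/-- The frequency profile of the spacetime gradient. -/
def prof {I : Set ℝ} {f : ℝ × E2 → ℝ} (hf : SchwartzOnI I f) {t₀ : ℝ} (ht : t₀ ∈ I) (ξ : E2) :
    ℝ≥0∞ := ∑ c, ‖𝓕 (dS hf ht c) ξ‖ₑ

lemma slice_apply {I : Set ℝ} {f : ℝ × E2 → ℝ} (hf : SchwartzOnI I f) {t₀ : ℝ} (ht : t₀ ∈ I)
    (y : E2) : slice hf ht y = (f (t₀, y) : ℂ) := rfl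

lemma dS_apply {I : Set ℝ} {f : ℝ × E2 → ℝ} (hf : SchwartzOnI I f) {t₀ : ℝ} (ht : t₀ ∈ I)
    (c : Fin 3) (y : E2) : dS hf ht c y = (fderiv ℝ f (t₀, y) (dirs c) : ℂ) := rfl

lemma measurable_prof {I : Set ℝ} {f : ℝ × E2 → ℝ} (hf : SchwartzOnI I f) {t₀ : ℝ}
    (ht : t₀ ∈ I) : Measurable (prof hf ht) := by
  unfold prof
  apply Finset.measurable_fun_sum
  intro c _
  exact (𝓕 (dS hf ht c)).continuous.enorm.measurable

/-- The Littlewood-Paley piece of a profile. -/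
def Qp (ϕ : E2 → ℝ) (k : ℤ) (W : E2 → ℝ≥0∞) : ℝ≥0∞ := ∫⁻ ξ, (‖lpSymb ϕ k ξ‖ₑ * W ξ) ^ 2

lemma symb_measurable {ϕ : E2 → ℝ} (hϕ : IsLPBump ϕ) (k : ℤ) :
    Measurable (fun ξ => ‖lpSymb ϕ k ξ‖ₑ) := by
  have := hϕ.1.continuous
  have h : Continuous (fun ξ => lpSymb ϕ k ξ) := by
    unfold lpSymb
    fun_prop
  exact h.enorm.measurable

lemma gradLP2_sq {ϕ : E2 → ℝ} (hϕ : IsLPBump ϕ) (k : ℤ) {I : Set ℝ} {f : ℝ × E2 → ℝ}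
    (hf : SchwartzOnI I f) {t₀ : ℝ} (ht : t₀ ∈ I) :
    ENNReal.ofReal (gradLP2 ϕ k t₀ f) ^ 2 =
      ∑ c, ∫⁻ ξ, (‖lpSymb ϕ k ξ‖ₑ * ‖𝓕 (dS hf ht c) ξ‖ₑ) ^ 2 := by
  have p0 := lpProj_plancherel hϕ k (fun y => dT f (t₀, y)) (dS hf ht 0) (fun y => rfl)
  have p1 := lpProj_plancherel hϕ k (fun y => dX 0 f (t₀, y)) (dS hf ht 1) (fun y => rfl)
  have p2 := lpProj_plancherel hϕ k (fun y => dX 1 f (t₀, y)) (dS hf ht 2) (fun y => rfl)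
  have hg : 0 ≤ gradLP2 ϕ k t₀ f := Real.sqrt_nonneg _
  rw [Fin.sum_univ_three, ← p0.2, ← p1.2, ← p2.2, ← ENNReal.ofReal_pow hg]
  have hi := integral_add (p0.1.add p1.1) p2.1
  simp only [Pi.add_apply] at hi
  unfold gradLP2
  rw [Real.sq_sqrt (by positivity), hi, integral_add p0.1 p1.1,
    ENNReal.ofReal_add (by positivity) (by positivity),
    ENNReal.ofReal_add (by positivity) (by positivity)]

lemma gradLP2_le {ϕ : E2 → ℝ} (hϕ : IsLPBump ϕ) (k : ℤ) {I : Set ℝ} {f : ℝ × E2 → ℝ}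
    (hf : SchwartzOnI I f) {t₀ : ℝ} (ht : t₀ ∈ I) :
    ENNReal.ofReal (gradLP2 ϕ k t₀ f) ^ 2 ≤ Qp ϕ k (prof hf ht) := by
  rw [gradLP2_sq hϕ k hf ht, ← lintegral_finsetSum]
  · apply lintegral_mono
    intro ξ
    simp only [prof, Fin.sum_univ_three]
    generalize ‖lpSymb ϕ k ξ‖ₑ = s
    generalize ‖𝓕 (dS hf ht 0) ξ‖ₑ = a
    generalize ‖𝓕 (dS hf ht 1) ξ‖ₑ = b
    generalize ‖𝓕 (dS hf ht 2) ξ‖ₑ = c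
    calc (s * a) ^ 2 + (s * b) ^ 2 + (s * c) ^ 2
        ≤ (s * a) ^ 2 + (s * b) ^ 2 + (s * c) ^ 2 + 2 * s ^ 2 * (a * b + b * c + c * a) :=
          le_self_add
      _ = (s * (a + b + c)) ^ 2 := by ring
  · intro c _
    exact ((symb_measurable hϕ k).mul (𝓕 (dS hf ht c)).continuous.enorm.measurable).pow_const 2

lemma ennreal_add_sq_le (a b : ℝ≥0∞) : (a + b) ^ 2 ≤ 2 * a ^ 2 + 2 * b ^ 2 := by
  have := cs_tsum (fun _ : Fin 2 => (1 : ℝ≥0∞)) ![a, b]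
  simp only [tsum_fintype, Fin.sum_univ_two, Matrix.cons_val_zero, Matrix.cons_val_one, one_mul,
    one_pow] at this
  rw [one_add_one_eq_two, mul_add] at this
  exact this

lemma le_gradLP2 {ϕ : E2 → ℝ} (hϕ : IsLPBump ϕ) (k : ℤ) {I : Set ℝ} {f : ℝ × E2 → ℝ}
    (hf : SchwartzOnI I f) {t₀ : ℝ} (ht : t₀ ∈ I) :
    Qp ϕ k (prof hf ht) ≤ 3 * ENNReal.ofReal (gradLP2 ϕ k t₀ f) ^ 2 := by
  rw [gradLP2_sq hϕ k hf ht, ← lintegral_finsetSum, ← lintegral_const_mul']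
  · apply lintegral_mono
    intro ξ
    simp only [prof, Finset.mul_sum]
    have := cs_tsum (fun _ : Fin 3 => (1 : ℝ≥0∞))
      (fun c => ‖lpSymb ϕ k ξ‖ₑ * ‖𝓕 (dS hf ht c) ξ‖ₑ)
    simp only [tsum_fintype, one_mul, one_pow] at this
    refine this.trans (le_of_eq ?_)
    rw [Finset.mul_sum]
    simp
  · simp
  · intro c _
    exact ((symb_measurable hϕ k).mul (𝓕 (dS hf ht c)).continuous.enorm.measurable).pow_const 2

lemma shift_le {c : ℝ} (h0 : 0 ≤ c) (h1 : c ≤ 1) (n k l : ℤ) (hkl : (k - l).natAbs ≤ 1) :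
    tw (-(c * (n - l).natAbs)) ≤ 2 * tw (-(c * (n - k).natAbs)) := by
  have e : (2 : ℝ≥0∞) = tw 1 := by simp [tw]
  rw [e, ← tw_add]
  apply tw_mono
  have : (n - k).natAbs ≤ (n - l).natAbs + 1 := by omega
  have : ((n - k).natAbs : ℝ) ≤ (n - l).natAbs + 1 := by exact_mod_cast this
  nlinarith

lemma Qp_le {ϕ : E2 → ℝ} (hϕ : IsLPBump ϕ) {M : ℝ} (hM : ∀ k ξ, |lpSymb ϕ k ξ| ≤ M)
    {W : E2 → ℝ≥0∞} (hW : Measurable W) {c : ℝ} (h0 : 0 ≤ c) (h1 : c ≤ 1) (n : ℤ) (D : ℝ≥0∞)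
    (hD : ∀ j, ∫⁻ ξ in ann j, W ξ ^ 2 ≤ (D * tw (-(c * (n - j).natAbs))) ^ 2) (k : ℤ) :
    Qp ϕ k W ≤ (3 * ENNReal.ofReal M * D * tw (-(c * (n - k).natAbs))) ^ 2 := by
  calc Qp ϕ k W ≤ ∫⁻ ξ, (ann (k - 1)).indicator (fun ξ => (ENNReal.ofReal M * W ξ) ^ 2) ξ +
        (ann k).indicator (fun ξ => (ENNReal.ofReal M * W ξ) ^ 2) ξ := by
        apply lintegral_mono
        intro ξ
        have hb : (‖lpSymb ϕ k ξ‖ₑ * W ξ) ^ 2 ≤ (ENNReal.ofReal M * W ξ) ^ 2 := by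
          gcongr
          rw [← ofReal_norm]
          exact ENNReal.ofReal_le_ofReal (hM k ξ)
        simp only
        by_cases a1 : ξ ∈ ann (k - 1)
        · rw [Set.indicator_of_mem a1]
          exact hb.trans le_self_add
        · by_cases a2 : ξ ∈ ann k
          · rw [Set.indicator_of_mem a2]
            exact hb.trans le_add_self
          · rw [symb_zero hϕ k a1 a2]; simp
    _ = ENNReal.ofReal M ^ 2 * ((∫⁻ ξ in ann (k - 1), W ξ ^ 2) + ∫⁻ ξ in ann k, W ξ ^ 2) := by
        rw [lintegral_add_left, lintegral_indicator (measurableSet_ann _),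
          lintegral_indicator (measurableSet_ann _)]
        · simp only [mul_pow]
          rw [lintegral_const_mul _ (by fun_prop), lintegral_const_mul _ (by fun_prop), mul_add]
        · exact Measurable.indicator (by fun_prop) (measurableSet_ann _)
    _ ≤ ENNReal.ofReal M ^ 2 * ((D * (2 * tw (-(c * (n - k).natAbs)))) ^ 2 +
          (D * tw (-(c * (n - k).natAbs))) ^ 2) := by
        gcongr
        · refine (hD (k - 1)).trans ?_
          gcongr
          exact shift_le h0 h1 n k (k - 1) (by simp)
        · exact hD k
    _ = 5 * (ENNReal.ofReal M * D * tw (-(c * (n - k).natAbs))) ^ 2 := by ring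
    _ ≤ 9 * (ENNReal.ofReal M * D * tw (-(c * (n - k).natAbs))) ^ 2 := by
        gcongr
        norm_num
    _ = _ := by ring

lemma ann_le {ϕ : E2 → ℝ} (hϕ : IsLPBump ϕ)
    {W : E2 → ℝ≥0∞} (hW : Measurable W) {c : ℝ} (h0 : 0 ≤ c) (h1 : c ≤ 1) (n : ℤ) (D : ℝ≥0∞)
    (hD : ∀ j, Qp ϕ j W ≤ (D * tw (-(c * (n - j).natAbs))) ^ 2) (k : ℤ) :
    ∫⁻ ξ in ann k, W ξ ^ 2 ≤ (4 * D * tw (-(c * (n - k).natAbs))) ^ 2 := by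
  have m1 := symb_measurable hϕ
  calc ∫⁻ ξ in ann k, W ξ ^ 2 ≤ ∫⁻ ξ in ann k, (2 * (‖lpSymb ϕ k ξ‖ₑ * W ξ) ^ 2 +
        2 * (‖lpSymb ϕ (k + 1) ξ‖ₑ * W ξ) ^ 2) := by
        apply setLIntegral_mono' (measurableSet_ann k)
        intro ξ hξ
        have h1 : (1 : ℝ≥0∞) ≤ ‖lpSymb ϕ k ξ‖ₑ + ‖lpSymb ϕ (k + 1) ξ‖ₑ := by
          have := enorm_add_le (lpSymb ϕ k ξ) (lpSymb ϕ (k + 1) ξ)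
          rwa [symb_one hϕ k hξ, enorm_one] at this
        refine le_trans ?_ (ennreal_add_sq_le _ _)
        gcongr
        rw [← add_mul]
        exact le_mul_of_one_le_left' h1
    _ ≤ ∫⁻ ξ, (2 * (‖lpSymb ϕ k ξ‖ₑ * W ξ) ^ 2 +
        2 * (‖lpSymb ϕ (k + 1) ξ‖ₑ * W ξ) ^ 2) := setLIntegral_le_lintegral _ _
    _ = 2 * Qp ϕ k W + 2 * Qp ϕ (k + 1) W := by
        rw [lintegral_add_left, lintegral_const_mul, lintegral_const_mul]
        · rfl
        · exact ((m1 (k + 1)).mul hW).pow_const 2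
        · exact ((m1 k).mul hW).pow_const 2
        · exact (((m1 k).mul hW).pow_const 2).const_mul 2
    _ ≤ 2 * (D * tw (-(c * (n - k).natAbs))) ^ 2 +
          2 * (D * (2 * tw (-(c * (n - k).natAbs)))) ^ 2 := by
        gcongr
        · exact hD k
        · refine (hD (k + 1)).trans ?_
          gcongr
          exact shift_le h0 h1 n k (k + 1) (by simp)
    _ = 10 * (D * tw (-(c * (n - k).natAbs))) ^ 2 := by ring
    _ ≤ 16 * (D * tw (-(c * (n - k).natAbs))) ^ 2 := by
        gcongr
        norm_num
    _ = _ := by ring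

/-- Crude decay of profiles. -/
lemma prof_decay {I : Set ℝ} {f : ℝ × E2 → ℝ} (hf : SchwartzOnI I f) {t₀ : ℝ} (ht : t₀ ∈ I) :
    ∃ D : ℝ, ∀ j, ∫⁻ ξ in ann j, prof hf ht ξ ^ 2 ≤
      (ENNReal.ofReal D * tw (-(1 * ((0 : ℤ) - j).natAbs))) ^ 2 := by
  have hc : ∀ N : ℕ, ∃ C : ℝ, 0 ≤ C ∧ ∀ ξ, ENNReal.ofReal (‖ξ‖ ^ N) * prof hf ht ξ ≤ ENNReal.ofReal C := by
    intro N
    choose C hC0 hC using fun c => (𝓕 (dS hf ht c)).decay N 0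
    refine ⟨∑ c, C c, Finset.sum_nonneg fun c _ => (hC0 c).le, fun ξ => ?_⟩
    rw [prof, Finset.mul_sum, ENNReal.ofReal_sum_of_nonneg (fun c _ => (hC0 c).le)]
    gcongr with c
    rw [← ofReal_norm, ← ENNReal.ofReal_mul (by positivity)]
    apply ENNReal.ofReal_le_ofReal
    simpa using hC c ξ
  obtain ⟨C0, hC0, h0⟩ := hc 0
  obtain ⟨C2, hC2, h2⟩ := hc 2
  set C := max C0 C2
  have hC : 0 ≤ C := hC0.trans (le_max_left _ _)
  refine ⟨4 * C, fun j => ?_⟩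
  have vol : volume (ann j) ≤ (4 * tw j) ^ 2 := by
    refine (volume_ann j).trans ?_
    rw [mul_pow, tw_sq]
    gcongr
    calc ENNReal.ofReal (4 * Real.pi) ≤ ENNReal.ofReal (4 ^ 2) := by
          apply ENNReal.ofReal_le_ofReal; linarith [Real.pi_le_four]
      _ = _ := by norm_num
  have fin : ∀ K : ℝ≥0∞, (∀ ξ ∈ ann j, prof hf ht ξ ≤ K) →
      ∫⁻ ξ in ann j, prof hf ht ξ ^ 2 ≤ (K * (4 * tw j)) ^ 2 := by
    intro K hK
    calc _ ≤ ∫⁻ ξ in ann j, K ^ 2 := by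
          apply setLIntegral_mono' (measurableSet_ann j)
          intro ξ hξ
          gcongr
          exact hK ξ hξ
      _ = K ^ 2 * volume (ann j) := setLIntegral_const _ _
      _ ≤ _ := by rw [mul_pow]; gcongr
  have e4 : ENNReal.ofReal (4 * C) = 4 * ENNReal.ofReal C := by
    rw [ENNReal.ofReal_mul (by norm_num)]; norm_num
  by_cases hj : j ≤ 0
  · refine (fin (ENNReal.ofReal C) fun ξ _ => ?_).trans ?_
    · have := h0 ξ
      simp at this
      exact this.trans (ENNReal.ofReal_le_ofReal (le_max_left _ _))
    · rw [e4]
      have : (-(1 * (((0 : ℤ) - j).natAbs : ℝ))) = j := by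
        have : (((0 : ℤ) - j).natAbs : ℤ) = -j := by omega
        rw [← Int.cast_natCast (R := ℝ), this]
        push_cast
        ring
      rw [this]
      apply le_of_eq; ring
  · refine (fin (ENNReal.ofReal C * tw (-(2 * j))) fun ξ hξ => ?_).trans ?_
    · have h := h2 ξ
      have a : tw (2 * j) ≤ ENNReal.ofReal (‖ξ‖ ^ 2) := by
        rw [← tw_sq, tw_int, ← ENNReal.ofReal_pow (by positivity)]
        apply ENNReal.ofReal_le_ofReal
        have := hξ.1
        gcongr
      calc prof hf ht ξ = tw (2 * j) * prof hf ht ξ * tw (-(2 * j)) := by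
            rw [mul_comm, ← mul_assoc, ← tw_add]; simp [tw_zero]
        _ ≤ ENNReal.ofReal (‖ξ‖ ^ 2) * prof hf ht ξ * tw (-(2 * j)) := by gcongr
        _ ≤ _ := by
            gcongr
            exact h.trans (ENNReal.ofReal_le_ofReal (le_max_right _ _))
    · rw [e4]
      have : (-(1 * (((0 : ℤ) - j).natAbs : ℝ))) = -(2 * j) + j := by
        have : (((0 : ℤ) - j).natAbs : ℤ) = j := by omega
        rw [← Int.cast_natCast (R := ℝ), this]
        push_cast
        ring
      rw [this, tw_add]
      apply le_of_eq; ring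


lemma fderiv_slice {I : Set ℝ} {f : ℝ × E2 → ℝ} (hf : SchwartzOnI I f) {t₀ : ℝ} (ht : t₀ ∈ I)
    (v y : E2) : fderiv ℝ (slice hf ht) y v = ((fderiv ℝ f (t₀, y) (0, v) : ℝ) : ℂ) := by
  have hd : HasFDerivAt f (fderiv ℝ f (t₀, y)) (t₀, y) :=
    (hf.1.differentiable (by simp) _).hasFDerivAt
  have h2 : HasFDerivAt (fun y : E2 => (t₀, y)) (ContinuousLinearMap.inr ℝ ℝ E2) y :=
    hasFDerivAt_prodMk_right t₀ y
  have h3 := (Complex.ofRealCLM.hasFDerivAt (x := f (t₀, y))).comp y (hd.comp y h2)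
  have h4 : HasFDerivAt (slice hf ht) _ y := h3
  rw [h4.fderiv]
  simp

lemma fourier_line {I : Set ℝ} {f : ℝ × E2 → ℝ} (hf : SchwartzOnI I f) {t₀ : ℝ} (ht : t₀ ∈ I)
    (i : Fin 2) (ξ : E2) :
    ‖𝓕 (∂_{(EuclideanSpace.single i (1 : ℝ) : E2)} (slice hf ht)) ξ‖ =
      2 * Real.pi * |ξ i| * ‖𝓕 (slice hf ht) ξ‖ := by
  rw [SchwartzMap.fourier_lineDerivOp_eq]
  have : (fun x : E2 => inner ℝ x (EuclideanSpace.single i (1 : ℝ) : E2)).HasTemperateGrowth := by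
    fun_prop
  rw [SchwartzMap.smul_apply, SchwartzMap.smulLeftCLM_apply_apply this]
  simp [norm_smul, EuclideanSpace.inner_single_right, abs_of_pos Real.pi_pos, mul_assoc]

lemma dS_one {I : Set ℝ} {f : ℝ × E2 → ℝ} (hf : SchwartzOnI I f) {t₀ : ℝ} (ht : t₀ ∈ I) :
    dS hf ht 1 = ∂_{(EuclideanSpace.single 0 (1 : ℝ) : E2)} (slice hf ht) := by
  ext y
  rw [SchwartzMap.lineDerivOp_apply_eq_fderiv, fderiv_slice, dS_apply]
  rfl

lemma dS_two {I : Set ℝ} {f : ℝ × E2 → ℝ} (hf : SchwartzOnI I f) {t₀ : ℝ} (ht : t₀ ∈ I) :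
    dS hf ht 2 = ∂_{(EuclideanSpace.single 1 (1 : ℝ) : E2)} (slice hf ht) := by
  ext y
  rw [SchwartzMap.lineDerivOp_apply_eq_fderiv, fderiv_slice, dS_apply]
  rfl

lemma slice_le_prof {I : Set ℝ} {f : ℝ × E2 → ℝ} (hf : SchwartzOnI I f) {t₀ : ℝ} (ht : t₀ ∈ I)
    {ξ : E2} (hξ : ξ ≠ 0) :
    ‖𝓕 (slice hf ht) ξ‖ₑ ≤ prof hf ht ξ * ENNReal.ofReal ‖ξ‖⁻¹ := by
  have hp : 0 < ‖ξ‖ := norm_pos_iff.2 hξ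
  have hn : ‖ξ‖ ≤ |ξ 0| + |ξ 1| := by
    rw [EuclideanSpace.norm_eq, Real.sqrt_le_left (by positivity)]
    simp only [Fin.sum_univ_two, Real.norm_eq_abs]
    nlinarith [abs_nonneg (ξ 0), abs_nonneg (ξ 1)]
  have key : ‖𝓕 (slice hf ht) ξ‖ ≤ (‖𝓕 (dS hf ht 1) ξ‖ + ‖𝓕 (dS hf ht 2) ξ‖) * ‖ξ‖⁻¹ := by
    rw [← div_eq_mul_inv, le_div_iff₀ hp, dS_one, dS_two, fourier_line, fourier_line]
    have h0 := norm_nonneg (𝓕 (slice hf ht) ξ)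
    have hpi : 1 ≤ 2 * Real.pi := by linarith [Real.pi_gt_three]
    calc ‖𝓕 (slice hf ht) ξ‖ * ‖ξ‖ ≤ ‖𝓕 (slice hf ht) ξ‖ * (|ξ 0| + |ξ 1|) := by gcongr
      _ ≤ (2 * Real.pi) * (‖𝓕 (slice hf ht) ξ‖ * (|ξ 0| + |ξ 1|)) :=
          le_mul_of_one_le_left (by positivity) hpi
      _ = _ := by ring
  rw [← ofReal_norm]
  refine (ENNReal.ofReal_le_ofReal key).trans ?_
  rw [ENNReal.ofReal_mul (by positivity), ENNReal.ofReal_add (by positivity) (by positivity),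
    ofReal_norm, ofReal_norm]
  gcongr
  rw [prof, Fin.sum_univ_three, add_assoc]
  exact le_add_self

lemma schwartzOnI_mul {I : Set ℝ} {f g : ℝ × E2 → ℝ} (hf : SchwartzOnI I f)
    (hg : SchwartzOnI I g) : SchwartzOnI I (fun p => f p * g p) := by
  refine ⟨hf.1.mul hg.1, fun n N => ?_⟩
  choose C hC using fun i => hf.2 i N
  choose D hD using fun i => hg.2 i 0
  refine ⟨∑ i ∈ Finset.range (n + 1), (n.choose i : ℝ) * |C i| * |D (n - i)|, fun p hp => ?_⟩
  calc _ ≤ ‖p.2‖ ^ N * ∑ i ∈ Finset.range (n + 1),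
      (n.choose i : ℝ) * ‖iteratedFDeriv ℝ i f p‖ * ‖iteratedFDeriv ℝ (n - i) g p‖ := by
        gcongr
        exact norm_iteratedFDeriv_mul_le hf.1 hg.1 p (mod_cast le_top)
    _ = ∑ i ∈ Finset.range (n + 1), (n.choose i : ℝ) * (‖p.2‖ ^ N * ‖iteratedFDeriv ℝ i f p‖) *
          (‖p.2‖ ^ 0 * ‖iteratedFDeriv ℝ (n - i) g p‖) := by
        rw [Finset.mul_sum]
        apply Finset.sum_congr rfl
        intro i _
        ring
    _ ≤ _ := by
        gcongr with i hi
        · exact (hC i p hp).trans (le_abs_self _)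
        · exact (hD (n - i) p hp).trans (le_abs_self _)

lemma dS_mul {I : Set ℝ} {f g : ℝ × E2 → ℝ} (hf : SchwartzOnI I f)
    (hg : SchwartzOnI I g) {t₀ : ℝ} (ht : t₀ ∈ I) (c : Fin 3) :
    dS (schwartzOnI_mul hf hg) ht c =
      SchwartzMap.pairing (ContinuousLinearMap.mul ℂ ℂ) (dS hf ht c) (slice hg ht) +
      SchwartzMap.pairing (ContinuousLinearMap.mul ℂ ℂ) (dS hg ht c) (slice hf ht) := by
  ext y
  rw [SchwartzMap.add_apply, SchwartzMap.pairing_apply_apply, SchwartzMap.pairing_apply_apply]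
  simp only [dS_apply, slice_apply, ContinuousLinearMap.mul_apply']
  have := fderiv_fun_mul (𝕜 := ℝ) (hf.1.differentiable (by simp) (t₀, y))
    (hg.1.differentiable (by simp) (t₀, y))
  rw [this]
  simp only [ContinuousLinearMap.add_apply, ContinuousLinearMap.smul_apply, smul_eq_mul]
  push_cast
  ring

lemma ae_conv_le {I : Set ℝ} {g : ℝ × E2 → ℝ} (hg : SchwartzOnI I g) {t₀ : ℝ} (ht : t₀ ∈ I)
    (U : E2 → ℝ≥0∞) (ξ : E2) :
    ∫⁻ η, U (ξ - η) * ‖𝓕 (slice hg ht) η‖ₑ ≤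
      ∫⁻ η, U (ξ - η) * (prof hg ht η * ENNReal.ofReal ‖η‖⁻¹) := by
  apply lintegral_mono_ae
  have : ∀ᵐ η : E2, η ≠ 0 := by
    rw [ae_iff]
    simp
  filter_upwards [this] with η hη
  gcongr
  exact slice_le_prof hg ht hη

lemma prof_half {I : Set ℝ} {f g : ℝ × E2 → ℝ} (hf : SchwartzOnI I f)
    (hg : SchwartzOnI I g) {t₀ : ℝ} (ht : t₀ ∈ I) (ξ : E2) :
    ∑ c, ‖𝓕 (SchwartzMap.pairing (ContinuousLinearMap.mul ℂ ℂ) (dS hf ht c) (slice hg ht)) ξ‖ₑ ≤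
      ∫⁻ η, prof hf ht (ξ - η) * (prof hg ht η * ENNReal.ofReal ‖η‖⁻¹) := by
  refine le_trans ?_ (ae_conv_le hg ht _ ξ)
  simp only [prof, Finset.sum_mul]
  rw [lintegral_finsetSum]
  · gcongr with c
    exact fourier_mul_le _ _ _
  · intro c _
    have h1 := (𝓕 (dS hf ht c)).continuous
    have h2 := (𝓕 (slice hg ht)).continuous
    exact ((h1.comp (continuous_const.sub continuous_id)).enorm.measurable).mul h2.enorm.measurable

lemma prof_mul_le {I : Set ℝ} {f g : ℝ × E2 → ℝ} (hf : SchwartzOnI I f)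
    (hg : SchwartzOnI I g) {t₀ : ℝ} (ht : t₀ ∈ I) (ξ : E2) :
    prof (schwartzOnI_mul hf hg) ht ξ ≤
      (∫⁻ η, prof hf ht (ξ - η) * (prof hg ht η * ENNReal.ofReal ‖η‖⁻¹)) +
      ∫⁻ η, prof hg ht (ξ - η) * (prof hf ht η * ENNReal.ofReal ‖η‖⁻¹) := by
  refine le_trans ?_ (add_le_add (prof_half hf hg ht ξ) (prof_half hg hf ht ξ))
  rw [prof, ← Finset.sum_add_distrib]
  gcongr with c
  rw [dS_mul, FourierTransform.fourier_add, SchwartzMap.add_apply]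
  exact enorm_add_le _ _

lemma ennreal_le_of_sq {a b : ℝ≥0∞} (h : a ^ 2 ≤ b ^ 2) : a ≤ b :=
  (ENNReal.pow_right_strictMono two_ne_zero).le_iff_le.1 h

lemma conv_measurable {U V : E2 → ℝ≥0∞} (hU : Measurable U) (hV : Measurable V) :
    Measurable (fun ξ => ∫⁻ η, U (ξ - η) * (V η * ENNReal.ofReal ‖η‖⁻¹)) := by
  apply Measurable.lintegral_prod_right'
    (f := fun p : E2 × E2 => U (p.1 - p.2) * (V p.2 * ENNReal.ofReal ‖p.2‖⁻¹))
  fun_prop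

lemma besov_bdd {δ : ℝ} (h0 : 0 < δ) (h1 : δ ≤ 1 / 100) {ϕ : E2 → ℝ} (hϕ : IsLPBump ϕ)
    {I : Set ℝ} {f : ℝ × E2 → ℝ} (hf : SchwartzOnI I f) {t₀ : ℝ} (ht : t₀ ∈ I) (k : ℤ) :
    BddAbove (Set.range fun k' : ℤ =>
      (2 : ℝ) ^ (δ * ((k - k').natAbs : ℝ)) * gradLP2 ϕ k' t₀ f) := by
  obtain ⟨M, hM0, hM⟩ := symb_bound hϕ
  obtain ⟨D, hD⟩ := prof_decay hf ht
  refine ⟨3 * M * |D| * 2 ^ (δ * k.natAbs), ?_⟩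
  rintro _ ⟨k', rfl⟩
  have h := (gradLP2_le hϕ k' hf ht).trans
    (Qp_le hϕ hM (measurable_prof hf ht) zero_le_one le_rfl 0 _ hD k')
  have h2 := ennreal_le_of_sq h
  have h3 : ENNReal.ofReal (gradLP2 ϕ k' t₀ f) ≤
      ENNReal.ofReal (3 * M * |D| * 2 ^ (-(1 * (((0 : ℤ) - k').natAbs : ℝ)))) := by
    rw [ENNReal.ofReal_mul (by positivity), ENNReal.ofReal_mul (by positivity),
      ENNReal.ofReal_mul (by positivity), ← tw_ofReal]
    refine h2.trans ?_
    gcongr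
    · simp
    · exact le_abs_self D
  rw [ENNReal.ofReal_le_ofReal_iff (by positivity)] at h3
  calc _ ≤ (2 : ℝ) ^ (δ * ((k - k').natAbs : ℝ)) *
        (3 * M * |D| * 2 ^ (-(1 * (((0 : ℤ) - k').natAbs : ℝ)))) :=
          mul_le_mul_of_nonneg_left h3 (by positivity)
    _ = 3 * M * |D| * 2 ^ (δ * ((k - k').natAbs : ℝ) + -(1 * (((0 : ℤ) - k').natAbs : ℝ))) := by
        rw [Real.rpow_add (by norm_num)]; ring
    _ ≤ _ := by
        gcongr
        · norm_num
        have a : (k - k').natAbs ≤ k.natAbs + ((0 : ℤ) - k').natAbs := by omega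
        have a' : ((k - k').natAbs : ℝ) ≤ k.natAbs + ((0 : ℤ) - k').natAbs := by exact_mod_cast a
        have b : (0 : ℝ) ≤ (((0 : ℤ) - k').natAbs : ℝ) := by positivity
        nlinarith

lemma gradLP2_nonneg (ϕ : E2 → ℝ) (k : ℤ) (t₀ : ℝ) (f : ℝ × E2 → ℝ) : 0 ≤ gradLP2 ϕ k t₀ f :=
  Real.sqrt_nonneg _

lemma besovS_nonneg (δ : ℝ) (ϕ : E2 → ℝ) (t₀ : ℝ) (k : ℤ) (f : ℝ × E2 → ℝ) :
    0 ≤ besovS δ ϕ t₀ k f :=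
  Real.iSup_nonneg fun k' => mul_nonneg (by positivity) (gradLP2_nonneg _ _ _ _)

/-- Annular bounds for the profile in terms of the seminorm. -/
lemma prof_ann {δ : ℝ} (h0 : 0 < δ) (h1 : δ ≤ 1 / 100) {ϕ : E2 → ℝ} (hϕ : IsLPBump ϕ)
    {I : Set ℝ} {f : ℝ × E2 → ℝ} (hf : SchwartzOnI I f) {t₀ : ℝ} (ht : t₀ ∈ I) (k j : ℤ) :
    ∫⁻ ξ in ann j, prof hf ht ξ ^ 2 ≤
      (8 * ENNReal.ofReal (besovS δ ϕ t₀ k f) * tw (-(δ * (k - j).natAbs))) ^ 2 := by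
  have key : ∀ l, Qp ϕ l (prof hf ht) ≤
      (2 * ENNReal.ofReal (besovS δ ϕ t₀ k f) * tw (-(δ * (k - l).natAbs))) ^ 2 := by
    intro l
    refine (le_gradLP2 hϕ l hf ht).trans ?_
    have hs : (2 : ℝ) ^ (δ * ((k - l).natAbs : ℝ)) * gradLP2 ϕ l t₀ f ≤ besovS δ ϕ t₀ k f :=
      le_ciSup (besov_bdd h0 h1 hϕ hf ht k) l
    have hs2 : gradLP2 ϕ l t₀ f ≤ besovS δ ϕ t₀ k f * 2 ^ (-(δ * ((k - l).natAbs : ℝ))) := by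
      rw [Real.rpow_neg (by norm_num), ← div_eq_mul_inv, le_div_iff₀ (by positivity), mul_comm]
      exact hs
    have hs3 : ENNReal.ofReal (gradLP2 ϕ l t₀ f) ≤
        ENNReal.ofReal (besovS δ ϕ t₀ k f) * tw (-(δ * (k - l).natAbs)) := by
      rw [tw_ofReal, ← ENNReal.ofReal_mul (besovS_nonneg _ _ _ _ _)]
      exact ENNReal.ofReal_le_ofReal hs2
    calc 3 * ENNReal.ofReal (gradLP2 ϕ l t₀ f) ^ 2
        ≤ 4 * (ENNReal.ofReal (besovS δ ϕ t₀ k f) * tw (-(δ * (k - l).natAbs))) ^ 2 := by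
          gcongr
          norm_num
      _ = _ := by ring
  refine (ann_le hϕ (measurable_prof hf ht) h0.le (by linarith) k _ key j).trans (le_of_eq ?_)
  ring

/-- The core estimate with a cleaner constant. -/
lemma core' {δ : ℝ} (h0 : 0 < δ) (h1 : δ ≤ 1 / 100) {U V : E2 → ℝ≥0∞}
    (hU : Measurable U) (hV : Measurable V) (A B : ℝ≥0∞) (k₁ k₂ : ℤ)
    (hA : ∀ i, ∫⁻ ξ in ann i, U ξ ^ 2 ≤ (A * tw (-(δ * (k₁ - i).natAbs))) ^ 2)
    (hB : ∀ i, ∫⁻ ξ in ann i, V ξ ^ 2 ≤ (B * tw (-(δ * (k₂ - i).natAbs))) ^ 2) (k : ℤ) :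
    ∫⁻ ξ in ann k, (∫⁻ η, U (ξ - η) * (V η * ENNReal.ofReal ‖η‖⁻¹)) ^ 2 ≤
      (4 * (tw 4 * geo (1/4) * (2 * geo δ)) * A * B * tw (-(δ * (max k₁ k₂ - k).natAbs))) ^ 2 := by
  refine (core h0 h1 hU hV A B k₁ k₂ hA hB k).trans ?_
  have : ENNReal.ofReal (4 * Real.pi) ≤ 16 := by
    calc ENNReal.ofReal (4 * Real.pi) ≤ ENNReal.ofReal 16 := by
          apply ENNReal.ofReal_le_ofReal; linarith [Real.pi_le_four]
      _ = _ := by norm_num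
  calc _ ≤ 16 * (tw 4 * geo (1/4) * (2 * geo δ)) ^ 2 *
        (A * B * tw (-(δ * (max k₁ k₂ - k).natAbs))) ^ 2 := by gcongr
    _ = _ := by ring

lemma prof_mul_ann {δ : ℝ} (h0 : 0 < δ) (h1 : δ ≤ 1 / 100) {ϕ : E2 → ℝ} (hϕ : IsLPBump ϕ)
    {I : Set ℝ} {f g : ℝ × E2 → ℝ} (hf : SchwartzOnI I f) (hg : SchwartzOnI I g) {t₀ : ℝ}
    (ht : t₀ ∈ I) (k₁ k₂ j : ℤ) :
    ∫⁻ ξ in ann j, prof (schwartzOnI_mul hf hg) ht ξ ^ 2 ≤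
      (512 * (tw 4 * geo (1/4) * (2 * geo δ)) * ENNReal.ofReal (besovS δ ϕ t₀ k₁ f) *
        ENNReal.ofReal (besovS δ ϕ t₀ k₂ g) * tw (-(δ * (max k₁ k₂ - j).natAbs))) ^ 2 := by
  have mf := measurable_prof hf ht
  have mg := measurable_prof hg ht
  have c1 := core' h0 h1 mf mg _ _ k₁ k₂ (prof_ann h0 h1 hϕ hf ht k₁) (prof_ann h0 h1 hϕ hg ht k₂) j
  have c2 := core' h0 h1 mg mf _ _ k₂ k₁ (prof_ann h0 h1 hϕ hg ht k₂) (prof_ann h0 h1 hϕ hf ht k₁) j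
  rw [max_comm k₂ k₁] at c2
  have m1 := conv_measurable mf mg
  calc _ ≤ ∫⁻ ξ in ann j,
        (2 * (∫⁻ η, prof hf ht (ξ - η) * (prof hg ht η * ENNReal.ofReal ‖η‖⁻¹)) ^ 2 +
        2 * (∫⁻ η, prof hg ht (ξ - η) * (prof hf ht η * ENNReal.ofReal ‖η‖⁻¹)) ^ 2) := by
        apply lintegral_mono
        intro ξ
        refine le_trans ?_ (ennreal_add_sq_le _ _)
        exact pow_le_pow_left' (prof_mul_le hf hg ht ξ) 2
    _ ≤ _ := by
        rw [lintegral_add_left ((m1.pow_const 2).const_mul 2), lintegral_const_mul' _ _ (by simp),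
          lintegral_const_mul' _ _ (by simp)]
        refine (add_le_add (mul_le_mul_right c1 2) (mul_le_mul_right c2 2)).trans (le_of_eq ?_)
        ring

lemma gradLP2_mul {δ : ℝ} (h0 : 0 < δ) (h1 : δ ≤ 1 / 100) {ϕ : E2 → ℝ} (hϕ : IsLPBump ϕ)
    {M : ℝ} (hM : ∀ k ξ, |lpSymb ϕ k ξ| ≤ M)
    {I : Set ℝ} {f g : ℝ × E2 → ℝ} (hf : SchwartzOnI I f) (hg : SchwartzOnI I g) {t₀ : ℝ}
    (ht : t₀ ∈ I) (k₁ k₂ k : ℤ) :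
    gradLP2 ϕ k t₀ (fun p => f p * g p) ≤
      (3 * ENNReal.ofReal M * (512 * (tw 4 * geo (1/4) * (2 * geo δ)))).toReal *
        besovS δ ϕ t₀ k₁ f * besovS δ ϕ t₀ k₂ g * 2 ^ (-(δ * ((max k₁ k₂ - k).natAbs : ℝ))) := by
  have hfg := schwartzOnI_mul hf hg
  have h := ennreal_le_of_sq ((gradLP2_le hϕ k hfg ht).trans
    (Qp_le hϕ hM (measurable_prof hfg ht) h0.le (by linarith) (max k₁ k₂) _
      (prof_mul_ann h0 h1 hϕ hf hg ht k₁ k₂) k))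
  have b1 := besovS_nonneg δ ϕ t₀ k₁ f
  have b2 := besovS_nonneg δ ϕ t₀ k₂ g
  rw [← ENNReal.ofReal_le_ofReal_iff (by positivity), ENNReal.ofReal_mul (by positivity),
    ENNReal.ofReal_mul (by positivity), ENNReal.ofReal_mul (by positivity), ← tw_ofReal,
    ENNReal.ofReal_toReal]
  · refine h.trans (le_of_eq ?_)
    ring
  · have := geo_ne_top h0
    have := geo_ne_top (c := 1 / 4) (by norm_num)
    have := tw_ne_top 4
    finiteness


/-- Product estimate for the Besov-type Littlewood–Paley seminorm: provided `δ₁` is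
sufficiently small (an absolute smallness condition), one has
`‖fg‖_{S_{max(k₁,k₂)}(t₀)} ≤ C ‖f‖_{S_{k₁}(t₀)} ‖g‖_{S_{k₂}(t₀)}` for all Schwartz
functions `f, g` on `I × ℝ²`, with `C` depending only on `δ₁` and `ϕ`. -/
theorem besov_product_estimate :
    ∃ δbar > (0 : ℝ), ∀ δ₁ : ℝ, 0 < δ₁ → δ₁ ≤ 1 / 100 → δ₁ ≤ δbar →
      ∀ ϕ : E2 → ℝ, IsLPBump ϕ →
      ∃ C > (0 : ℝ), ∀ I : Set ℝ, IsCompact I → ∀ t₀ ∈ I,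
        ∀ f g : ℝ × E2 → ℝ, SchwartzOnI I f → SchwartzOnI I g →
        ∀ k₁ k₂ : ℤ,
          besovS δ₁ ϕ t₀ (max k₁ k₂) (fun p => f p * g p)
            ≤ C * besovS δ₁ ϕ t₀ k₁ f * besovS δ₁ ϕ t₀ k₂ g := by
  refine ⟨1, one_pos, fun δ₁ h0 h1 _ ϕ hϕ => ?_⟩
  obtain ⟨M, hM0, hM⟩ := symb_bound hϕ
  refine ⟨(3 * ENNReal.ofReal M * (512 * (tw 4 * geo (1/4) * (2 * geo δ₁)))).toReal + 1,
    by positivity, fun I _ t₀ ht f g hf hg k₁ k₂ => ?_⟩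
  have b1 := besovS_nonneg δ₁ ϕ t₀ k₁ f
  have b2 := besovS_nonneg δ₁ ϕ t₀ k₂ g
  refine ciSup_le fun k => ?_
  have h := gradLP2_mul h0 h1 hϕ hM hf hg ht k₁ k₂ k
  set K := (3 * ENNReal.ofReal M * (512 * (tw 4 * geo (1/4) * (2 * geo δ₁)))).toReal
  calc _ ≤ (2 : ℝ) ^ (δ₁ * ((max k₁ k₂ - k).natAbs : ℝ)) *
        (K * besovS δ₁ ϕ t₀ k₁ f * besovS δ₁ ϕ t₀ k₂ g *
          2 ^ (-(δ₁ * ((max k₁ k₂ - k).natAbs : ℝ)))) := by gcongr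
    _ = K * besovS δ₁ ϕ t₀ k₁ f * besovS δ₁ ϕ t₀ k₂ g := by
        rw [Real.rpow_neg (by norm_num)]
        field_simp
    _ ≤ _ := by
        gcongr
        linarith


end
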